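/- For a group X the following are equivalent: (1) the superextension λ(X) is commutative, i.e. A∘B = B∘A for all maximal linked systems A, B on X; (2) X is finite and |X| ≤ 4. -/

import Mathlib

open Pointwise

/-- A family `L` of subsets of `X` is *linked* if any two of its members intersect
(in particular every member is nonempty). -/
def Linked {X : Type*} (L : Set (Set X)) : Prop :=
  ∀ A ∈ L, ∀ B ∈ L, (A ∩ B).Nonempty

/-- A family `L` of subsets of a group `X` is *invariant* if `xA ∈ L` for all `A ∈ L`
and all `x ∈ X`. -/
def Invariant {X : Type*} [Group X] (L : Set (Set X)) : Prop :=
  ∀ x : X, ∀ A ∈ L, x • A ∈ L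

/-- A *maximal invariant linked system* on a group `X` is an invariant linked family of
subsets of `X` not properly contained in any other invariant linked family. -/
def IsMaxInvLinked {X : Type*} [Group X] (L : Set (Set X)) : Prop :=
  Linked L ∧ Invariant L ∧
    ∀ M : Set (Set X), Linked M → Invariant M → L ⊆ M → M = L

/-- A *maximal linked system* on `X` is a linked family of subsets of `X` not properly
contained in any other linked family. -/
def IsMaxLinked {X : Type*} (L : Set (Set X)) : Prop :=
  Linked L ∧ ∀ M : Set (Set X), Linked M → L ⊆ M → M = L

/-- The operation `A∘B = {C ⊆ X : {x ∈ X : x⁻¹C ∈ B} ∈ A}`, where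
`x⁻¹C = {y ∈ X : xy ∈ C}`. -/
def circ {X : Type*} [Group X] (A B : Set (Set X)) : Set (Set X) :=
  {C : Set X | {x : X | (x * ·) ⁻¹' C ∈ B} ∈ A}

theorem Linked.exists_isMaxLinked {X : Type*} {L : Set (Set X)} (hL : Linked L) :
    ∃ M, L ⊆ M ∧ IsMaxLinked M := by
  obtain ⟨M, hLM, hM⟩ := zorn_subset_nonempty {L : Set (Set X) | Linked L} (by
    intro c hc hchain _
    refine ⟨⋃₀ c, ?_, fun s hs => Set.subset_sUnion_of_mem hs⟩
    rintro A ⟨K, hK, hAK⟩ B ⟨K', hK', hBK'⟩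
    rcases hchain.total hK hK' with h | h
    · exact hc hK' A (h hAK) B hBK'
    · exact hc hK A hAK B (h hBK')) L hL
  exact ⟨M, hLM, hM.prop, fun N hN hMN => (hM.eq_of_subset hN hMN).symm⟩

namespace IsMaxLinked

variable {X : Type*} {L : Set (Set X)}

theorem mem_of_forall_inter (hL : IsMaxLinked L) {C : Set X} (hC : C.Nonempty)
    (h : ∀ A ∈ L, (A ∩ C).Nonempty) : C ∈ L := by
  rw [← hL.2 (insert C L) ?_ (Set.subset_insert C L)]
  · exact Set.mem_insert C L
  · rintro A (rfl | hA) B (rfl | hB)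
    · simpa using hC
    · rw [Set.inter_comm]
      exact h B hB
    · exact h A hA
    · exact hL.1 A hA B hB

theorem mem_of_superset (hL : IsMaxLinked L) {A B : Set X} (hA : A ∈ L) (hAB : A ⊆ B) :
    B ∈ L :=
  hL.mem_of_forall_inter (((hL.1 A hA A hA).mono Set.inter_subset_left).mono hAB)
    fun D hD => (hL.1 D hD A hA).mono (Set.inter_subset_inter_right D hAB)

theorem empty_notMem (hL : IsMaxLinked L) : ∅ ∉ L :=
  fun h => by simpa using hL.1 ∅ h ∅ h

theorem compl_notMem (hL : IsMaxLinked L) {C : Set X} (hC : C ∈ L) : Cᶜ ∉ L :=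
  fun h => by simpa using hL.1 C hC Cᶜ h

theorem univ_mem [Nonempty X] (hL : IsMaxLinked L) : Set.univ ∈ L :=
  hL.mem_of_forall_inter Set.univ_nonempty fun A hA => by simpa using hL.1 A hA A hA

theorem compl_mem [Nonempty X] (hL : IsMaxLinked L) {C : Set X} (hC : C ∉ L) : Cᶜ ∈ L := by
  rcases C.eq_empty_or_nonempty with rfl | hne
  · simpa using hL.univ_mem
  · by_contra hcompl
    refine hC (hL.mem_of_forall_inter hne fun A hA => ?_)
    by_contra hdisj
    refine hcompl (hL.mem_of_superset hA ?_)
    rw [Set.subset_compl_iff_disjoint_right, Set.disjoint_iff_inter_eq_empty]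
    exact Set.not_nonempty_iff_eq_empty.mp hdisj

end IsMaxLinked

theorem isMaxLinked_principal {X : Type*} (a : X) : IsMaxLinked {C : Set X | a ∈ C} := by
  refine ⟨fun A hA B hB => ⟨a, hA, hB⟩, fun M hM hsub => hsub.antisymm' fun C hC => ?_⟩
  simpa using hM {a} (hsub rfl) C hC

/-- If the superextension of a group is commutative, then so is the group. -/
theorem mul_comm_of_circ_comm {X : Type*} [Group X]
    (h : ∀ A B : Set (Set X), IsMaxLinked A → IsMaxLinked B → circ A B = circ B A) (a b : X) :
    a * b = b * a := by
  have key : ({a * b} : Set X) ∈ circ {C | b ∈ C} {C | a ∈ C} := by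
    rw [← h _ _ (isMaxLinked_principal a) (isMaxLinked_principal b)]
    exact rfl
  exact (show b * a = a * b from key).symm

/-- A finite configuration witnessing that the superextension is not commutative. -/
theorem exists_circ_ne {X : Type*} [Group X] (C S T : Set X) (hS : S.Nonempty)
    (hT : T.Nonempty)
    (hST : ∀ x ∈ S, ∃ t ∈ T, x * t ∈ C) (hTS : ∀ y ∈ T, ∃ s ∈ S, y * s ∉ C)
    (hSS : ∀ x ∈ S, ∀ x' ∈ S, ∃ z, x * z ∈ C ∧ x' * z ∈ C)
    (hTT : ∀ y ∈ T, ∀ y' ∈ T, ∃ z, y * z ∉ C ∧ y' * z ∉ C) :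
    ∃ A B : Set (Set X), IsMaxLinked A ∧ IsMaxLinked B ∧ circ A B ≠ circ B A := by
  have hA₀ : Linked (insert S ((fun y => (y * ·) ⁻¹' Cᶜ) '' T)) := by
    rintro _ (rfl | ⟨y, hy, rfl⟩) _ (rfl | ⟨y', hy', rfl⟩)
    · simpa using hS
    · exact hTS y' hy'
    · obtain ⟨s, hs, hsC⟩ := hTS y hy
      exact ⟨s, hsC, hs⟩
    · exact hTT y hy y' hy'
  have hB₀ : Linked (insert T ((fun x => (x * ·) ⁻¹' C) '' S)) := by
    rintro _ (rfl | ⟨x, hx, rfl⟩) _ (rfl | ⟨x', hx', rfl⟩)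
    · simpa using hT
    · exact hST x' hx'
    · obtain ⟨t, ht, htC⟩ := hST x hx
      exact ⟨t, htC, ht⟩
    · exact hSS x hx x' hx'
  obtain ⟨A, hA₀A, hA⟩ := hA₀.exists_isMaxLinked
  obtain ⟨B, hB₀B, hB⟩ := hB₀.exists_isMaxLinked
  refine ⟨A, B, hA, hB, fun hAB => ?_⟩
  have hC : C ∈ circ A B :=
    hA.mem_of_superset (hA₀A (Set.mem_insert _ _)) fun x hx =>
      hB₀B (Set.mem_insert_of_mem _ ⟨x, hx, rfl⟩)
  rw [hAB] at hC
  obtain ⟨y, hyC, hyT⟩ := hB.1 _ hC T (hB₀B (Set.mem_insert _ _))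
  exact hA.compl_notMem hyC (hA₀A (Set.mem_insert_of_mem _ ⟨y, hyT, rfl⟩))

theorem exists_circ_ne_of_sq_eq_one {X : Type*} [CommGroup X] {a u v : X} (ha : a ≠ 1)
    (haa : a * a = 1) (hu : u ∉ ({1, a} : Set X)) (hv : v ∉ ({1, a, u, u * a} : Set X)) :
    ∃ A B : Set (Set X), IsMaxLinked A ∧ IsMaxLinked B ∧ circ A B ≠ circ B A := by
  simp only [Set.mem_insert_iff, Set.mem_singleton_iff, not_or] at hu hv
  have haC : a ∉ ({1, u, u * a} : Set X) := by
    simpa [ha, eq_comm, and_comm] using hu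
  have hvC : v ∉ ({1, u, u * a} : Set X) := by
    simp [hv]
  have hvaC : a * v ∉ ({1, u, u * a} : Set X) := by
    have hinv : a⁻¹ = a := inv_eq_of_mul_eq_one_left haa
    simp only [Set.mem_insert_iff, Set.mem_singleton_iff, not_or]
    refine ⟨fun h => hv.2.1 ?_, fun h => hv.2.2.2 ?_, fun h => hv.2.2.1 ?_⟩
    · rw [eq_inv_of_mul_eq_one_right h, hinv]
    · rw [← h, mul_right_comm, haa, one_mul]
    · rwa [mul_comm, mul_left_inj] at h
  refine exists_circ_ne {1, u, u * a} {1, a} {1, a} (by simp) (by simp) ?_ ?_ ?_ ?_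
  · rintro x (rfl | rfl)
    · exact ⟨1, by simp⟩
    · exact ⟨x, by simp [haa]⟩
  · rintro y (rfl | rfl)
    · exact ⟨a, by simp, by simpa using haC⟩
    · exact ⟨1, by simp, by simpa using haC⟩
  · have h (x) (hx : x ∈ ({1, a} : Set X)) : x * u ∈ ({1, u, u * a} : Set X) := by
      rcases hx with rfl | rfl <;> simp [mul_comm]
    exact fun x hx x' hx' => ⟨u, h x hx, h x' hx'⟩
  · have h (y) (hy : y ∈ ({1, a} : Set X)) : y * v ∉ ({1, u, u * a} : Set X) := by
      rcases hy with rfl | rfl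
      · simpa using hvC
      · exact hvaC
    exact fun y hy y' hy' => ⟨v, h y hy, h y' hy'⟩

theorem exists_circ_ne_of_sq_ne_one {X : Type*} [CommGroup X] {a v : X} (ha : a ≠ 1)
    (haa : a * a ≠ 1) (hv : v ∉ ({1, a, a * a, a * a * a} : Set X)) :
    ∃ A B : Set (Set X), IsMaxLinked A ∧ IsMaxLinked B ∧ circ A B ≠ circ B A := by
  simp only [Set.mem_insert_iff, Set.mem_singleton_iff, not_or] at hv
  have hainv : a⁻¹ ∉ ({1, a} : Set X) := by
    simp [ha, inv_eq_iff_mul_eq_one, haa]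
  have haaC : a * a ∉ ({1, a} : Set X) := by
    simp [ha, haa]
  refine exists_circ_ne {1, a} {1, a⁻¹} {1, a * a} (by simp) (by simp) ?_ ?_ ?_ ?_
  · rintro x (rfl | rfl)
    · exact ⟨1, by simp⟩
    · exact ⟨a * a, by simp⟩
  · rintro y (rfl | rfl)
    · exact ⟨a⁻¹, by simp, by simpa using hainv⟩
    · exact ⟨1, by simp, by simpa using haaC⟩
  · have h (x) (hx : x ∈ ({1, a⁻¹} : Set X)) : x * a ∈ ({1, a} : Set X) := by
      rcases hx with rfl | rfl <;> simp
    exact fun x hx x' hx' => ⟨a, h x hx, h x' hx'⟩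
  · have h (y) (hy : y ∈ ({1, a * a} : Set X)) : y * (v * (a * a)⁻¹) ∉ ({1, a} : Set X) := by
      rcases hy with rfl | rfl
      · simp only [one_mul, Set.mem_insert_iff, Set.mem_singleton_iff, mul_inv_eq_iff_eq_mul]
        simpa [mul_assoc] using hv.2.2
      · rw [mul_comm v, mul_inv_cancel_left]
        simp [hv]
    exact fun y hy y' hy' => ⟨_, h y hy, h y' hy'⟩

/-- The set coded by `s` could be `{x | x⁻¹C ∈ B}` for a maximal linked system `B`, where `C` is
the set coded by `c`. -/
def CompatibleTranslates {G : Type*} [Mul G] (c s : G → Bool) : Prop :=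
  ∀ x y, ((∀ z, ¬(c (x * z) ∧ c (y * z))) → ¬(s x ∧ s y)) ∧
    ((∀ z, c (x * z) ∨ c (y * z)) → s x ∨ s y)

/-- For every set `c`, the compatible sets other than the translates of `c` are all empty or all
the whole group. -/
def TranslateDichotomy (G : Type*) [Mul G] : Prop :=
  ∀ c : G → Bool, ∃ b : Bool, ∀ s : G → Bool, CompatibleTranslates c s →
    (∀ x, s x = b) ∨ ∃ y, ∀ x, s x = c (y * x)

instance {G : Type*} [Mul G] [Fintype G] (c s : G → Bool) :
    Decidable (CompatibleTranslates c s) := by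
  unfold CompatibleTranslates; infer_instance

instance {G : Type*} [Mul G] [Fintype G] [DecidableEq G] : Decidable (TranslateDichotomy G) := by
  unfold TranslateDichotomy; infer_instance

theorem TranslateDichotomy.of_mulEquiv {G H : Type*} [Mul G] [Mul H] (e : G ≃* H)
    (h : TranslateDichotomy G) : TranslateDichotomy H := by
  intro c
  obtain ⟨b, hb⟩ := h (c ∘ e)
  refine ⟨b, fun s hs => ?_⟩
  have hcomp : CompatibleTranslates (c ∘ e) (s ∘ e) := by
    intro x y
    simpa [e.surjective.forall] using hs (e x) (e y)
  rcases hb _ hcomp with h | ⟨y, hy⟩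
  · exact Or.inl (e.surjective.forall.mpr h)
  · exact Or.inr ⟨e y, e.surjective.forall.mpr (by simpa using hy)⟩

theorem translateDichotomy_of_isCyclic {G : Type*} [Group G] [Finite G] [IsCyclic G]
    (h : Nat.card G ≤ 4) : TranslateDichotomy G := by
  have hpos : 0 < Nat.card G := Nat.card_pos
  refine TranslateDichotomy.of_mulEquiv (zmodCyclicMulEquiv (G := G) inferInstance) ?_
  generalize Nat.card G = n at h hpos
  interval_cases n <;> decide

theorem translateDichotomy_of_card_le_four {G : Type*} [Group G] [Finite G]
    (h : Nat.card G ≤ 4) : (∀ a b : G, a * b = b * a) ∧ TranslateDichotomy G := by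
  by_cases hcyc : IsCyclic G
  · exact ⟨fun a b => IsCyclic.commGroup.mul_comm a b, translateDichotomy_of_isCyclic h⟩
  · have hcard : Nat.card G = 4 := by
      have hpos : 0 < Nat.card G := Nat.card_pos
      by_contra hne
      refine hcyc ?_
      have hlt : Nat.card G = 1 ∨ Nat.card G = 2 ∨ Nat.card G = 3 := by lia
      rcases hlt with h1 | h2 | h3
      · have := (Nat.card_eq_one_iff_unique.mp h1).1
        exact isCyclic_of_subsingleton
      · exact isCyclic_of_prime_card (p := 2) h2
      · exact isCyclic_of_prime_card (p := 3) h3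
    have : IsKleinFour G :=
      ⟨hcard, (not_isCyclic_iff_exponent_eq_prime Nat.prime_two hcard).mp hcyc⟩
    obtain ⟨e⟩ := IsKleinFour.nonempty_mulEquiv (G₁ := Multiplicative (ZMod 2 × ZMod 2)) (G₂ := G)
    refine ⟨fun a b => e.symm.injective (by simp [mul_comm]), .of_mulEquiv e ?_⟩
    decide

theorem IsMaxLinked.compatibleTranslates {X : Type*} [Group X] {L : Set (Set X)}
    (hL : IsMaxLinked L) (C : Set X) [DecidablePred (· ∈ C)]
    [DecidablePred fun x : X => (x * ·) ⁻¹' C ∈ L] :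
    CompatibleTranslates (fun x => decide (x ∈ C)) (fun x => decide ((x * ·) ⁻¹' C ∈ L)) := by
  intro x y
  simp only [decide_eq_true_eq]
  refine ⟨fun h hxy => ?_, fun h => ?_⟩
  · obtain ⟨z, hz⟩ := hL.1 _ hxy.1 _ hxy.2
    exact h z hz
  · by_contra! hxy
    exact hxy.2 (hL.mem_of_superset (hL.compl_mem hxy.1) fun z hz => (h z).resolve_left hz)

theorem circ_comm_of_translateDichotomy {X : Type*} [CommGroup X] (hX : TranslateDichotomy X)
    {A B : Set (Set X)} (hA : IsMaxLinked A) (hB : IsMaxLinked B) : circ A B = circ B A := by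
  classical
  ext C
  obtain ⟨b, hb⟩ := hX fun x => decide (x ∈ C)
  have key {L : Set (Set X)} (hL : IsMaxLinked L) :
      {x : X | (x * ·) ⁻¹' C ∈ L} = (if b then Set.univ else ∅) ∨
        ∃ y : X, {x : X | (x * ·) ⁻¹' C ∈ L} = (y * ·) ⁻¹' C := by
    refine (hb _ (hL.compatibleTranslates C)).imp (fun h => ?_) (fun ⟨y, hy⟩ => ⟨y, ?_⟩)
    · ext x
      cases b <;> simpa using h x
    · ext x
      simpa using hy x
  have mem_iff {L : Set (Set X)} (x : X) : (x * ·) ⁻¹' C ∈ L ↔ x ∈ {x : X | (x * ·) ⁻¹' C ∈ L} :=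
    Iff.rfl
  change {x : X | (x * ·) ⁻¹' C ∈ B} ∈ A ↔ {x : X | (x * ·) ⁻¹' C ∈ A} ∈ B
  rcases key hA with h | ⟨y, hy⟩ <;> rcases key hB with h' | ⟨z, hz⟩
  · rw [h, h']
    cases b <;> simp [hA.empty_notMem, hB.empty_notMem, hA.univ_mem, hB.univ_mem]
  · rw [hz, mem_iff, h]
    cases b <;> simp [hB.empty_notMem, hB.univ_mem]
  · rw [hy, h', mem_iff (L := B), h']
    cases b <;> simp [hA.empty_notMem, hA.univ_mem]
  · rw [hz, mem_iff, hy, mem_iff, hz]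
    simp [mul_comm]

theorem exists_notMem_of_four {X : Type*} (hX : ¬(Finite X ∧ Nat.card X ≤ 4)) (p q r s : X) :
    ∃ v, v ∉ ({p, q, r, s} : Set X) := by
  by_contra! h
  have huniv : ({p, q, r, s} : Set X) = Set.univ := Set.eq_univ_of_forall h
  refine hX ⟨Set.finite_univ_iff.mp (huniv ▸ Set.toFinite _), ?_⟩
  rw [← Set.ncard_univ, ← huniv]
  classical
  simpa [Set.ncard_eq_toFinset_card'] using Finset.card_le_four (a := p) (b := q) (c := r) (d := s)

theorem exists_circ_ne_of_card {X : Type*} [CommGroup X] (hX : ¬(Finite X ∧ Nat.card X ≤ 4)) :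
    ∃ A B : Set (Set X), IsMaxLinked A ∧ IsMaxLinked B ∧ circ A B ≠ circ B A := by
  obtain ⟨a, ha⟩ := exists_notMem_of_four hX 1 1 1 1
  replace ha : a ≠ 1 := by simpa using ha
  by_cases haa : a * a = 1
  · obtain ⟨u, hu⟩ := exists_notMem_of_four hX 1 1 1 a
    obtain ⟨v, hv⟩ := exists_notMem_of_four hX 1 a u (u * a)
    exact exists_circ_ne_of_sq_eq_one ha haa (by simpa using hu) hv
  · obtain ⟨v, hv⟩ := exists_notMem_of_four hX 1 a (a * a) (a * a * a)
    exact exists_circ_ne_of_sq_ne_one ha haa hv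

/-- The superextension `λ(X)` of a group `X` is commutative (i.e. `A∘B = B∘A` for all
maximal linked systems `A`, `B` on `X`) if and only if `X` is finite and `|X| ≤ 4`. -/
theorem stmt19 {X : Type*} [Group X] :
    (∀ A B : Set (Set X), IsMaxLinked A → IsMaxLinked B → circ A B = circ B A) ↔
      (Finite X ∧ Nat.card X ≤ 4) := by
  refine ⟨fun h => ?_, fun ⟨_, hcard⟩ A B hA hB => ?_⟩
  · by_contra hX
    let _ : CommGroup X := { ‹Group X› with mul_comm := mul_comm_of_circ_comm h }
    obtain ⟨A, B, hA, hB, hne⟩ := exists_circ_ne_of_card hX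
    exact hne (h A B hA hB)
  · obtain ⟨hcomm, hdich⟩ := translateDichotomy_of_card_le_four hcard
    let _ : CommGroup X := { ‹Group X› with mul_comm := hcomm }
    exact circ_comm_of_translateDichotomy hdich hA hB
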